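/- arXiv:0804.2795 — 2 statements merged into one kernel-verified Lean document; each statement's English description precedes it below -/
import Mathlib

section
/- There exists a function φ : [0,1/2] → ℝ that is continuously differentiable on [0,1/2], three times continuously differentiable on (0,1/2), satisfies φ(η) > 0 for all η ∈ (0,1/2), φ(0) = φ(1/2) = 0, φ'(0) = 1, and φ(η)·φ'''(η) = 1 for all η ∈ (0,1/2). -/
/-- The traveling-wave profile problem (0.2) with d = 1/2:
`φ ∈ C¹[0,1/2] ∩ C³(0,1/2)`, `φ > 0` on `(0,1/2)`, `φ(0) = φ(1/2) = 0`,
`φ'(0) = 1` (one-sided derivative within `[0,1/2]`), and `φ·φ''' = 1` on `(0,1/2)`. -/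
def IsTWProfile (φ : ℝ → ℝ) : Prop :=
  ContDiffOn ℝ 1 φ (Set.Icc 0 (1/2)) ∧
  ContDiffOn ℝ 3 φ (Set.Ioo 0 (1/2)) ∧
  (∀ η ∈ Set.Ioo (0:ℝ) (1/2), 0 < φ η) ∧
  φ 0 = 0 ∧ φ (1/2) = 0 ∧
  derivWithin φ (Set.Icc 0 (1/2)) 0 = 1 ∧
  (∀ η ∈ Set.Ioo (0:ℝ) (1/2), φ η * deriv (deriv (deriv φ)) η = 1)

open Set Filter Topology MeasureTheory

namespace TW

noncomputable def cl (x : ℝ) : ℝ := max 0 (min x 1)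
noncomputable def cy (x : ℝ) : ℝ := max 0 (min x (7/8))

lemma cl_cont : Continuous cl := by unfold cl; fun_prop
lemma cy_cont : Continuous cy := by unfold cy; fun_prop
lemma cl_nonneg (x : ℝ) : 0 ≤ cl x := le_max_left _ _
lemma cl_le (x : ℝ) : cl x ≤ 1 := max_le zero_le_one (min_le_right _ _)
lemma cy_nonneg (x : ℝ) : 0 ≤ cy x := le_max_left _ _
lemma cy_le (x : ℝ) : cy x ≤ 7/8 := max_le (by norm_num) (min_le_right _ _)
lemma cl_eq {x : ℝ} (h0 : 0 ≤ x) (h1 : x ≤ 1) : cl x = x := by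
  unfold cl; rw [min_eq_left h1, max_eq_right h0]
lemma cy_eq {x : ℝ} (h0 : 0 ≤ x) (h1 : x ≤ 7/8) : cy x = x := by
  unfold cy; rw [min_eq_left h1, max_eq_right h0]
lemma cy_lip (a b : ℝ) : |cy a - cy b| ≤ |a - b| := by
  unfold cy
  refine (abs_max_sub_max_le_max _ _ _ _).trans ?_
  rw [sub_self, abs_zero]
  refine max_le (abs_nonneg _) ?_
  refine (abs_min_sub_min_le_max _ _ _ _).trans ?_
  simp

/-- kernel -/
noncomputable def ker (x θ : ℝ) : ℝ := θ * ((1 - cl x) / (1 - θ * cl x))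

lemma ker_nonneg (x : ℝ) {θ : ℝ} (h0 : 0 ≤ θ) (h1 : θ ≤ 1) : 0 ≤ ker x θ := by
  have := cl_nonneg x
  have := cl_le x
  have h : θ * cl x ≤ 1 := by nlinarith
  exact mul_nonneg h0 (div_nonneg (by linarith) (by linarith))

lemma ker_le (x : ℝ) {θ : ℝ} (h0 : 0 ≤ θ) (h1 : θ ≤ 1) : ker x θ ≤ θ := by
  have := cl_nonneg x
  have := cl_le x
  have h : θ * cl x ≤ 1 := by nlinarith
  have : (1 - cl x) / (1 - θ * cl x) ≤ 1 := div_le_one_of_le₀ (by nlinarith) (by linarith)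
  unfold ker
  nlinarith

lemma ker_meas (x : ℝ) : Measurable (ker x) := by unfold ker; fun_prop

noncomputable def J (y : ℝ → ℝ) (x : ℝ) : ℝ := ∫ θ in (0:ℝ)..1, ker x θ * cy (y (θ * cl x))

lemma integrand_meas {y : ℝ → ℝ} (hy : Continuous y) (x : ℝ) :
    Measurable (fun θ => ker x θ * cy (y (θ * cl x))) := by
  have h : Continuous (fun θ => cy (y (θ * cl x))) := cy_cont.comp (hy.comp (by fun_prop))
  exact (ker_meas x).mul h.measurable

lemma integrand_bd (y : ℝ → ℝ) (x : ℝ) {θ : ℝ} (h0 : 0 ≤ θ) (h1 : θ ≤ 1) :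
    ker x θ * cy (y (θ * cl x)) ≤ θ * (7/8) :=
  mul_le_mul (ker_le x h0 h1) (cy_le _) (cy_nonneg _) h0

lemma integrand_nonneg (y : ℝ → ℝ) (x : ℝ) {θ : ℝ} (h0 : 0 ≤ θ) (h1 : θ ≤ 1) :
    0 ≤ ker x θ * cy (y (θ * cl x)) :=
  mul_nonneg (ker_nonneg x h0 h1) (cy_nonneg _)

lemma integrand_norm (y : ℝ → ℝ) (x : ℝ) {θ : ℝ} (h : θ ∈ Set.uIoc (0:ℝ) 1) :
    ‖ker x θ * cy (y (θ * cl x))‖ ≤ 1 := by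
  rw [uIoc_of_le zero_le_one] at h
  rw [Real.norm_of_nonneg (integrand_nonneg y x h.1.le h.2)]
  have := integrand_bd y x h.1.le h.2
  linarith [h.2]

lemma integrand_int {y : ℝ → ℝ} (hy : Continuous y) (x : ℝ) :
    IntervalIntegrable (fun θ => ker x θ * cy (y (θ * cl x))) volume 0 1 := by
  refine (intervalIntegrable_const (c := (1:ℝ))).mono_fun
    (integrand_meas hy x).aestronglyMeasurable ?_
  refine (ae_restrict_iff' measurableSet_uIoc).2 (ae_of_all _ fun θ h => ?_)
  simpa using integrand_norm y x h

lemma J_cont {y : ℝ → ℝ} (hy : Continuous y) : Continuous (J y) := by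
  unfold J
  refine intervalIntegral.continuous_of_dominated_interval (bound := fun _ => 1)
    (fun x => (integrand_meas hy x).aestronglyMeasurable)
    (fun x => ae_of_all _ fun _ h => integrand_norm y x h) intervalIntegrable_const ?_
  have : ∀ᵐ θ : ℝ, θ ≠ 1 := by simp [ae_iff]
  filter_upwards [this] with θ h1 h
  rw [uIoc_of_le zero_le_one] at h
  have hlt : θ < 1 := lt_of_le_of_ne h.2 h1
  have hc := cl_cont
  refine Continuous.mul ?_ (cy_cont.comp (hy.comp (by fun_prop)))
  unfold ker
  refine continuous_const.mul (Continuous.div (by fun_prop) (by fun_prop) fun x => ?_)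
  have := cl_nonneg x
  have := cl_le x
  have := h.1
  nlinarith

lemma J_nonneg (y : ℝ → ℝ) (x : ℝ) : 0 ≤ J y x :=
  intervalIntegral.integral_nonneg zero_le_one fun θ h => integrand_nonneg y x h.1 h.2

lemma J_le {y : ℝ → ℝ} (hy : Continuous y) (x : ℝ) : J y x ≤ 7/16 := by
  have : J y x ≤ ∫ θ in (0:ℝ)..1, θ * (7/8) :=
    intervalIntegral.integral_mono_on zero_le_one (integrand_int hy x)
      (Continuous.intervalIntegrable (by fun_prop) _ _) fun θ h => integrand_bd y x h.1 h.2
  refine this.trans ?_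
  rw [intervalIntegral.integral_mul_const, integral_id]; norm_num

lemma J_lip {y z : ℝ → ℝ} (hy : Continuous y) (hz : Continuous z) {D : ℝ}
    (hD : ∀ x, |y x - z x| ≤ D) (x : ℝ) : |J y x - J z x| ≤ D / 2 := by
  unfold J
  rw [← intervalIntegral.integral_sub (integrand_int hy x) (integrand_int hz x)]
  have : ‖∫ θ in (0:ℝ)..1, (ker x θ * cy (y (θ * cl x)) - ker x θ * cy (z (θ * cl x)))‖
      ≤ ∫ θ in (0:ℝ)..1, θ * D := by
    refine intervalIntegral.norm_integral_le_of_norm_le zero_le_one (ae_of_all _ fun θ h => ?_)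
      (Continuous.intervalIntegrable (by fun_prop) _ _)
    rw [← mul_sub, norm_mul, Real.norm_of_nonneg (ker_nonneg x h.1.le h.2)]
    exact mul_le_mul (ker_le x h.1.le h.2) ((cy_lip _ _).trans (hD _)) (norm_nonneg _) h.1.le
  refine this.trans ?_
  rw [intervalIntegral.integral_mul_const, integral_id]; norm_num; linarith

lemma sqrt_lip {a b : ℝ} (ha : 1/4 ≤ a) (hb : 1/4 ≤ b) : |√a - √b| ≤ |a - b| := by
  have h1 : 1/2 ≤ √a := Real.le_sqrt_of_sq_le (by norm_num; linarith)
  have h2 : 1/2 ≤ √b := Real.le_sqrt_of_sq_le (by norm_num; linarith)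
  have e : a - b = (√a - √b) * (√a + √b) := by
    have := Real.sq_sqrt (show 0 ≤ a by linarith)
    have := Real.sq_sqrt (show 0 ≤ b by linarith)
    nlinarith
  rw [e, abs_mul, abs_of_nonneg (show 0 ≤ √a + √b by linarith)]
  nlinarith [abs_nonneg (√a - √b)]

open BoundedContinuousFunction in
noncomputable def T (y : ℝ →ᵇ ℝ) : ℝ →ᵇ ℝ :=
  BoundedContinuousFunction.ofNormedAddCommGroup (fun x => √(3/4 - J y x))
    ((continuous_const.sub (J_cont y.continuous)).sqrt) 1 (by
      intro x
      rw [Real.norm_of_nonneg (Real.sqrt_nonneg _)]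
      exact Real.sqrt_le_iff.2 ⟨by norm_num, by norm_num; linarith [J_nonneg y x]⟩)

lemma T_contr : ContractingWith (1/2) T := by
  refine ⟨by rw [← NNReal.coe_lt_coe]; norm_num, LipschitzWith.of_dist_le_mul fun y z => ?_⟩
  rw [BoundedContinuousFunction.dist_le (by positivity)]
  intro x
  have h := J_lip y.continuous z.continuous (D := dist y z)
    (fun x => by rw [← Real.dist_eq]; exact BoundedContinuousFunction.dist_coe_le_dist x) x
  have h2 := sqrt_lip (a := 3/4 - J y x) (b := 3/4 - J z x)
    (by linarith [J_le y.continuous x]) (by linarith [J_le z.continuous x])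
  change |√(3/4 - J y x) - √(3/4 - J z x)| ≤ _
  refine h2.trans ?_
  rw [show 3/4 - J y x - (3/4 - J z x) = -(J y x - J z x) by ring, abs_neg]
  refine h.trans (le_of_eq ?_)
  push_cast; ring

lemma exists_y : ∃ y : ℝ → ℝ, Continuous y ∧ (∀ x, 1/2 ≤ y x) ∧ (∀ x, y x ≤ 7/8) ∧
    y 1 = √(3/4) ∧ ∀ x ∈ Ioo (0:ℝ) 1,
      (x * y x)^2 = 3/4 * x^2 - (1 - x) * ∫ z in (0:ℝ)..x, z * y z / (1 - z) := by
  obtain ⟨y, hy⟩ : ∃ y, T y = y := ⟨_, T_contr.fixedPoint_isFixedPt⟩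
  have e : ∀ x, y x = √(3/4 - J y x) := fun x => by
    conv_lhs => rw [← hy]
    rfl
  have hlo : ∀ x, 1/2 ≤ y x := fun x => by
    rw [e]
    exact Real.le_sqrt_of_sq_le (by norm_num; linarith [J_le y.continuous x])
  have hhi : ∀ x, y x ≤ 7/8 := fun x => by
    rw [e]
    exact Real.sqrt_le_iff.2 ⟨by norm_num, by norm_num; linarith [J_nonneg y x]⟩
  refine ⟨y, y.continuous, hlo, hhi, ?_, ?_⟩
  · rw [e]
    simp [J, ker, cl]
  · intro x hx
    have hc : cl x = x := cl_eq hx.1.le hx.2.le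
    have h1 : (y x)^2 = 3/4 - J y x := by
      rw [e, Real.sq_sqrt]
      linarith [J_le y.continuous x]
    have h2 : x^2 * J y x = (1 - x) * ∫ z in (0:ℝ)..x, z * y z / (1 - z) := by
      have h3 := intervalIntegral.mul_integral_comp_mul_right (a := 0) (b := 1)
        (f := fun z => z * y z / (1 - z)) x
      simp only [zero_mul, one_mul] at h3
      rw [← h3, J, ← intervalIntegral.integral_const_mul, ← intervalIntegral.integral_const_mul,
        ← intervalIntegral.integral_const_mul]
      congr 1
      ext θ
      rw [ker, hc, cy_eq (by linarith [hlo (θ * x)]) (hhi _)]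
      ring
    rw [mul_pow, h1, ← h2]; ring

lemma exists_X {y : ℝ → ℝ} (hy : Continuous y) (hlo : ∀ x, 1/2 ≤ y x) (hhi : ∀ x, y x ≤ 7/8) :
    ∃ X : ℝ → ℝ, (∀ s, 0 < X s) ∧ X (1/2) = 1 ∧ (∀ s ∈ Ioo (0:ℝ) (1/2), X s < 1) ∧
      ∀ s, 0 < s → HasDerivAt X (X s * y (X s) / s) s := by
  have hpos : ∀ x, 0 < y x := fun x => by linarith [hlo x]
  have hc : Continuous fun σ => 1 / y (Real.exp σ) :=
    continuous_const.div (hy.comp Real.continuous_exp) fun σ => (hpos _).ne'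
  set M : ℝ → ℝ := fun τ => ∫ σ in (0:ℝ)..τ, 1 / y (Real.exp σ) with hM
  have hd : ∀ τ, HasDerivAt M (1 / y (Real.exp τ)) τ := fun τ =>
    intervalIntegral.integral_hasDerivAt_right (hc.intervalIntegrable _ _)
      (hc.stronglyMeasurableAtFilter _ _) hc.continuousAt
  have hM0 : M 0 = 0 := by simp [hM]
  have hge : ∀ x, 1 ≤ 1 / y x := fun x => by
    rw [le_div_iff₀ (hpos x)]; linarith [hhi x]
  have hmono : Monotone fun τ => M τ - τ := by
    refine monotone_of_deriv_nonneg (fun τ => ((hd τ).sub (hasDerivAt_id τ)).differentiableAt) ?_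
    intro τ
    have := ((hd τ).sub (hasDerivAt_id τ)).deriv
    have e : deriv (fun τ => M τ - τ) τ = 1 / y (Real.exp τ) - 1 := this
    rw [e]; linarith [hge (Real.exp τ)]
  have hstrict : StrictMono M := fun a b hab => by
    have := hmono hab.le
    simp only at this
    linarith
  have hcont : Continuous M := continuous_iff_continuousAt.2 fun τ => (hd τ).continuousAt
  have hsurj : Function.Surjective M := by
    refine hcont.surjective ?_ ?_
    · refine tendsto_atTop_mono' _ ?_ tendsto_id
      filter_upwards [eventually_ge_atTop 0] with τ h
      have := hmono h
      simp only [hM0] at this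
      simp only [id]; linarith
    · refine tendsto_atBot_mono' _ ?_ tendsto_id
      filter_upwards [eventually_le_atBot 0] with τ h
      have := hmono h
      simp only [hM0] at this
      simp only [id]; linarith
  let E := hstrict.orderIsoOfSurjective M hsurj
  have hEM : ∀ t, M (E.symm t) = t := fun t => E.apply_symm_apply t
  have hE0 : E.symm 0 = 0 := hstrict.injective (by rw [hEM, hM0])
  have hEd : ∀ t, HasDerivAt (fun t => E.symm t) (y (Real.exp (E.symm t))) t := fun t => by
    have := HasDerivAt.of_local_left_inverse (f := M) (g := fun t => E.symm t) (a := t)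
      E.symm.continuous.continuousAt (hd _) (one_div_pos.2 (hpos _)).ne'
      (Eventually.of_forall hEM)
    simpa using this
  refine ⟨fun s => Real.exp (E.symm (Real.log (2 * s))), fun s => Real.exp_pos _, ?_, ?_, ?_⟩
  · norm_num [hE0]
  · intro s hs
    rw [Real.exp_lt_one_iff, ← hE0]
    apply E.symm.strictMono
    apply Real.log_neg <;> linarith [hs.1, hs.2]
  · intro s hs
    have h1 : HasDerivAt (fun s => Real.log (2 * s)) (2 / (2 * s)) s := by
      have := ((hasDerivAt_id s).const_mul 2).log (by simpa using hs.ne')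
      simpa using this
    have := ((hEd _).comp s h1).exp
    refine this.congr_deriv ?_
    simp only [Function.comp]
    field_simp

/-- `g = x y(x)` and its derivative -/
lemma g_deriv {y : ℝ → ℝ} (hy : Continuous y) (hlo : ∀ x, 1/2 ≤ y x)
    (he : ∀ x ∈ Ioo (0:ℝ) 1,
      (x * y x)^2 = 3/4 * x^2 - (1 - x) * ∫ z in (0:ℝ)..x, z * y z / (1 - z))
    {x : ℝ} (hx : x ∈ Ioo (0:ℝ) 1) :
    HasDerivAt (fun x => x * y x)
      ((3/2 * x - x * y x + (3/4 * x^2 - (x * y x)^2) / (1 - x)) / (2 * (x * y x))) x := by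
  set N : ℝ → ℝ := fun x => ∫ z in (0:ℝ)..x, z * y z / (1 - z) with hN
  have hco : ContinuousOn (fun z => z * y z / (1 - z)) (Iio 1) :=
    ContinuousOn.div (by fun_prop) (by fun_prop) fun z hz => by
      have : z < 1 := hz
      linarith
  have hNd : HasDerivAt N (x * y x / (1 - x)) x := by
    refine intervalIntegral.integral_hasDerivAt_right ?_ ?_ ?_
    · refine (hco.mono ?_).intervalIntegrable
      rw [uIcc_of_le hx.1.le]
      exact fun z hz => lt_of_le_of_lt hz.2 hx.2
    · exact hco.stronglyMeasurableAtFilter isOpen_Iio x hx.2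
    · exact hco.continuousAt (Iio_mem_nhds hx.2)
  have hg : ∀ z ∈ Ioo (0:ℝ) 1, 0 < z * y z := fun z hz => mul_pos hz.1 (by linarith [hlo z])
  have hev : (fun x => x * y x) =ᶠ[𝓝 x] fun x => √(3/4 * x^2 - (1 - x) * N x) := by
    filter_upwards [isOpen_Ioo.mem_nhds hx] with z hz
    rw [← he z hz, Real.sqrt_sq (hg z hz).le]
  have hG : HasDerivAt (fun x => 3/4 * x^2 - (1 - x) * N x)
      (3/2 * x + N x - x * y x) x := by
    have h1x : (1 - x) ≠ 0 := by linarith [hx.2]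
    have := (((hasDerivAt_id x).pow 2).const_mul (3/4)).sub
      (((hasDerivAt_id x).const_sub 1).mul hNd)
    refine this.congr_deriv ?_
    simp only [id]
    field_simp
    ring
  have h0 : 3/4 * x^2 - (1 - x) * N x ≠ 0 := by
    rw [← he x hx]; exact (pow_pos (hg x hx) 2).ne'
  refine ((hG.sqrt h0).congr_of_eventuallyEq hev).congr_deriv ?_
  rw [← he x hx, Real.sqrt_sq (hg x hx).le, he x hx]
  have h1x : (1 - x) ≠ 0 := by linarith [hx.2]
  congr 1
  field_simp
  ring

/-- ODE regularity: the second order equation implies `C³` and the third order one. -/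
lemma ode_reg {φ ψ : ℝ → ℝ} (h1 : ∀ η, HasDerivAt φ (ψ η) η)
    (hpos : ∀ η ∈ Ioo (0:ℝ) (1/2), 0 < φ η)
    (h2 : ∀ η ∈ Ioo (0:ℝ) (1/2), HasDerivAt ψ (((ψ η)^2/2 - (1/2 - η)) / φ η) η) :
    ContDiffOn ℝ 3 φ (Ioo 0 (1/2)) ∧
    ∀ η ∈ Ioo (0:ℝ) (1/2), φ η * deriv (deriv (deriv φ)) η = 1 := by
  have e1 : deriv φ = ψ := funext fun η => (h1 η).deriv
  have hO : IsOpen (Ioo (0:ℝ) (1/2)) := isOpen_Ioo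
  have e2 : EqOn (deriv ψ) (fun η => ((ψ η)^2/2 - (1/2 - η)) / φ η) (Ioo 0 (1/2)) :=
    fun η h => (h2 η h).deriv
  have h3 : ∀ η ∈ Ioo (0:ℝ) (1/2),
      HasDerivAt (fun η => ((ψ η)^2/2 - (1/2 - η)) / φ η) (1 / φ η) η := by
    intro η h
    have hp := (hpos η h).ne'
    have := ((((h2 η h).pow 2).div_const 2).sub ((hasDerivAt_id η).const_sub (1/2))).div (h1 η) hp
    refine this.congr_deriv ?_
    simp only [id, Pi.pow_apply, Pi.sub_apply]
    field_simp
    push_cast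
    ring
  have h3' : ∀ η ∈ Ioo (0:ℝ) (1/2), HasDerivAt (deriv ψ) (1 / φ η) η := fun η h =>
    (h3 η h).congr_of_eventuallyEq (e2.eventuallyEq_of_mem (hO.mem_nhds h))
  have hφc : Continuous φ := continuous_iff_continuousAt.2 fun η => (h1 η).continuousAt
  constructor
  · rw [show (3 : WithTop ℕ∞) = 2 + 1 by norm_num, contDiffOn_succ_iff_deriv_of_isOpen hO]
    refine ⟨fun η _ => (h1 η).differentiableAt.differentiableWithinAt, by simp, ?_⟩
    rw [e1, show (2 : WithTop ℕ∞) = 1 + 1 by norm_num, contDiffOn_succ_iff_deriv_of_isOpen hO]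
    refine ⟨fun η h => (h2 η h).differentiableAt.differentiableWithinAt, by simp, ?_⟩
    rw [show (1 : WithTop ℕ∞) = 0 + 1 by norm_num, contDiffOn_succ_iff_deriv_of_isOpen hO]
    refine ⟨fun η h => (h3' η h).differentiableAt.differentiableWithinAt, by simp, ?_⟩
    rw [contDiffOn_zero]
    refine ContinuousOn.congr (f := fun η => 1 / φ η) ?_ fun η h => (h3' η h).deriv
    exact continuousOn_const.div hφc.continuousOn fun η h => (hpos η h).ne'
  · intro η h
    rw [e1, (h3' η h).deriv]
    have hp := (hpos η h).ne'
    field_simp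


lemma exists_F : ∃ F D : ℝ → ℝ, (∀ s, HasDerivAt F (D s) s) ∧ Continuous D ∧
    F 0 = 0 ∧ F (1/2) = 0 ∧ D (1/2) = -1 ∧ (∀ s ∈ Ioo (0:ℝ) (1/2), 0 < F s) ∧
    ∀ s ∈ Ioo (0:ℝ) (1/2), HasDerivAt D (((D s)^2/2 - s) / F s) s := by
  obtain ⟨y, hy, hlo, hhi, hy1, he⟩ := exists_y
  obtain ⟨X, hX0, hX1, hXlt, hXd⟩ := exists_X hy hlo hhi
  set A : ℝ := √(8/3) with hA
  have hA0 : 0 < A := Real.sqrt_pos.2 (by norm_num)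
  have hA2 : A^2 = 8/3 := Real.sq_sqrt (by norm_num)
  set F : ℝ → ℝ := fun s => A * (s * √s) * (1 - X s) with hF
  set D : ℝ → ℝ := fun s => A * √s * (3/2 * (1 - X s) - X s * y (X s)) with hD
  have hFneg : ∀ s ≤ 0, F s = 0 := fun s hs => by simp [hF, Real.sqrt_eq_zero_of_nonpos hs]
  have hDneg : ∀ s ≤ 0, D s = 0 := fun s hs => by simp [hD, Real.sqrt_eq_zero_of_nonpos hs]
  have hdpos : ∀ s, 0 < s → HasDerivAt F (D s) s := by
    intro s hs
    have hr : 0 < √s := Real.sqrt_pos.2 hs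
    have h1 := (((hasDerivAt_id s).mul (Real.hasDerivAt_sqrt hs.ne')).const_mul A).mul
      ((hXd s hs).const_sub 1)
    refine h1.congr_deriv ?_
    simp only [hD, id, Pi.mul_apply]
    have e : s = √s ^ 2 := (Real.sq_sqrt hs.le).symm
    generalize √s = r at *
    subst e
    field_simp
    ring
  have hdneg : ∀ s, s < 0 → HasDerivAt F (D s) s := by
    intro s hs
    rw [hDneg s hs.le]
    refine (hasDerivAt_const s (0:ℝ)).congr_of_eventuallyEq ?_
    filter_upwards [Iio_mem_nhds hs] with t ht using hFneg t (le_of_lt ht)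
  have hXle : ∀ s, 0 < s → s < 1/2 → X s < 1 := fun s h0 h1 => hXlt s ⟨h0, h1⟩
  have hsqrt : Tendsto (fun s => A * √s * 3) (𝓝 0) (𝓝 0) := by
    have : Continuous fun s => A * √s * 3 := by fun_prop
    simpa using this.tendsto 0
  have hhalf : ∀ᶠ s in 𝓝 (0:ℝ), s < 1/2 := Iio_mem_nhds (by norm_num)
  have hD0 : ContinuousAt D 0 := by
    unfold ContinuousAt
    rw [hDneg 0 le_rfl]
    refine squeeze_zero_norm' ?_ hsqrt
    filter_upwards [hhalf] with s hs
    rcases le_or_gt s 0 with h | h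
    · rw [hDneg s h]; simp; positivity
    · have h1 := hX0 s
      have h2 := hXle s h hs
      have h3 := hlo (X s)
      have h4 := hhi (X s)
      simp only [hD, norm_mul]
      rw [Real.norm_of_nonneg hA0.le, Real.norm_of_nonneg (Real.sqrt_nonneg _)]
      refine mul_le_mul_of_nonneg_left ?_ (by positivity)
      rw [Real.norm_eq_abs, abs_le]
      constructor <;> nlinarith
  have hF0 : ContinuousAt F 0 := by
    unfold ContinuousAt
    rw [hFneg 0 le_rfl]
    refine squeeze_zero_norm' ?_ hsqrt
    filter_upwards [hhalf] with s hs
    rcases le_or_gt s 0 with h | h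
    · rw [hFneg s h]; simp; positivity
    · have h1 := hX0 s
      have h2 := hXle s h hs
      simp only [hF, norm_mul]
      rw [Real.norm_of_nonneg hA0.le, Real.norm_of_nonneg (Real.sqrt_nonneg _),
        Real.norm_of_nonneg h.le, Real.norm_of_nonneg (by linarith : (0:ℝ) ≤ 1 - X s)]
      have : s * (1 - X s) ≤ 3 := by nlinarith
      have h5 : 0 ≤ A * √s := by positivity
      calc A * (s * √s) * (1 - X s) = A * √s * (s * (1 - X s)) := by ring
        _ ≤ _ := mul_le_mul_of_nonneg_left this h5
  have hdne : ∀ s, s ≠ 0 → HasDerivAt F (D s) s := fun s hs =>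
    (lt_or_gt_of_ne hs).elim (hdneg s) (hdpos s)
  have hd : ∀ s, HasDerivAt F (D s) s := by
    intro s
    rcases eq_or_ne s 0 with rfl | hs
    · exact hasDerivAt_of_hasDerivAt_of_ne hdne hF0 hD0
    · exact hdne s hs
  have hFp : ∀ s ∈ Ioo (0:ℝ) (1/2), 0 < F s := fun s hs => by
    have := hXlt s hs
    have := Real.sqrt_pos.2 hs.1
    exact mul_pos (mul_pos hA0 (mul_pos hs.1 this)) (by linarith)
  refine ⟨F, D, hd, ?_, hFneg 0 le_rfl, by simp only [hF, hX1]; simp, ?_, hFp, ?_⟩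
  · refine continuous_iff_continuousAt.2 fun s => ?_
    rcases lt_trichotomy s 0 with h | rfl | h
    · refine (continuousAt_const (y := (0:ℝ))).congr ?_
      filter_upwards [Iio_mem_nhds h] with t ht using (hDneg t (le_of_lt ht)).symm
    · exact hD0
    · have hXc : ContinuousAt X s := (hXd s h).continuousAt
      have hyc : ContinuousAt (fun s => y (X s)) s := hy.continuousAt.comp hXc
      have hsc : ContinuousAt (fun s => √s) s := Real.continuous_sqrt.continuousAt
      exact (continuousAt_const.mul hsc).mul
        ((continuousAt_const.mul (continuousAt_const.sub hXc)).sub (hXc.mul hyc))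
  · simp only [hD, hX1, hy1]
    have : A * √(1/2) * √(3/4) = 1 := by
      rw [hA, ← Real.sqrt_mul (by norm_num), ← Real.sqrt_mul (by norm_num)]
      norm_num
    linarith
  · intro s hs
    have hx : X s ∈ Ioo (0:ℝ) 1 := ⟨hX0 s, hXlt s hs⟩
    have hg := (g_deriv hy hlo he hx).comp s (hXd s hs.1)
    have hr : 0 < √s := Real.sqrt_pos.2 hs.1
    have h1 := ((Real.hasDerivAt_sqrt hs.1.ne').const_mul A).mul
      ((((hXd s hs.1).const_sub 1).const_mul (3/2)).sub hg)
    refine HasDerivAt.congr_deriv (f := D) h1 ?_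
    rw [eq_div_iff (hFp s hs).ne']
    have hy0 : 0 < y (X s) := by linarith [hlo (X s)]
    have hx0 := hX0 s
    have h1x : 1 - X s ≠ 0 := by linarith [hx.2]
    have e : s = √s ^ 2 := (Real.sq_sqrt hs.1.le).symm
    have key : ∀ r x Y a: ℝ, 0 < r → 0 < x → 0 < Y → 1 - x ≠ 0 →
      (a * (1 / (2 * r)) * (3/2 * (1 - x) - x * Y) + a * r * (3/2 * -(x * Y / r^2) -
        (3/2 * x - x * Y + (3/4 * x^2 - (x * Y)^2) / (1 - x)) / (2 * (x * Y)) * (x * Y / r^2))) *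
        (a * (r^2 * r) * (1 - x)) = (a * r * (3/2 * (1 - x) - x * Y))^2/2 - 3/8 * a^2 * r^2 := by
      intro r x Y a h1 h2 h3 h4
      field_simp
      ring
    have := key (√s) (X s) (y (X s)) A hr hx0 hy0 h1x
    rw [hA2, ← e] at this
    simp only [hF, hD, Pi.sub_apply, Function.comp]
    rw [this]
    ring

end TW

/-- Existence part of Theorem 1: there exists a traveling-wave profile. -/
theorem exists_traveling_wave_profile : ∃ φ : ℝ → ℝ, IsTWProfile φ := by
  obtain ⟨F, D, hd, hDc, hF0, hF1, hD1, hFp, hD2⟩ := TW.exists_F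
  have hmem : ∀ η ∈ Set.Ioo (0:ℝ) (1/2), (1/2 - η) ∈ Set.Ioo (0:ℝ) (1/2) := fun η h =>
    ⟨by linarith [h.2], by linarith [h.1]⟩
  have h1 : ∀ η, HasDerivAt (fun η => F (1/2 - η)) ((fun η => -D (1/2 - η)) η) η := fun η => by
    have := (hd (1/2 - η)).comp η ((hasDerivAt_id η).const_sub (1/2))
    refine this.congr_deriv ?_
    ring
  have h2 : ∀ η ∈ Set.Ioo (0:ℝ) (1/2), HasDerivAt (fun η => -D (1/2 - η))
      ((((fun η => -D (1/2 - η)) η)^2/2 - (1/2 - η)) / (fun η => F (1/2 - η)) η) η := by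
    intro η h
    have := ((hD2 _ (hmem η h)).comp η ((hasDerivAt_id η).const_sub (1/2))).neg
    refine this.congr_deriv ?_
    simp only
    ring
  obtain ⟨hC3, hode⟩ := TW.ode_reg h1 (fun η h => hFp _ (hmem η h)) h2
  have hC1 : ContDiff ℝ 1 (fun η => F (1/2 - η)) := by
    rw [contDiff_one_iff_deriv]
    refine ⟨fun η => (h1 η).differentiableAt, ?_⟩
    rw [show deriv (fun η => F (1/2 - η)) = fun η => -D (1/2 - η) from
      funext fun η => (h1 η).deriv]
    fun_prop
  refine ⟨fun η => F (1/2 - η), hC1.contDiffOn, hC3, fun η h => hFp _ (hmem η h), ?_, ?_, ?_, hode⟩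
  · simpa using hF1
  · simpa using hF0
  · rw [(h1 0).hasDerivWithinAt.derivWithin
      (uniqueDiffOn_Icc (by norm_num) 0 ⟨le_rfl, by norm_num⟩)]
    simp only [sub_zero, hD1, neg_neg]
end

section
/- There exists a constant C > 0 such that for every integer k ≥ 1 and every function φ : [0,1/2] → ℝ that is three times continuously differentiable on [0,1/2], positive on [0,1/2], and satisfies φ'''(η) = 1/φ(η) on [0,1/2], φ(0) = φ(1/2) = 1/k, φ'(0) = 1, one has φ(η) ≥ C·η·(1/2 − η)^{3/2} for all η ∈ [0,1/2]. -/
open Set Filter Topology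

/-- Nonnegative derivative on `[0,1/2]` implies the values lie above the initial value. -/
lemma aux_mono {f f' : ℝ → ℝ}
    (h : ∀ x ∈ Icc (0:ℝ) (1/2), HasDerivWithinAt f (f' x) (Icc 0 (1/2)) x)
    (h0 : ∀ x ∈ Icc (0:ℝ) (1/2), 0 ≤ f' x) :
    ∀ x ∈ Icc (0:ℝ) (1/2), f 0 ≤ f x := by
  have hm : MonotoneOn f (Icc (0:ℝ) (1/2)) := by
    apply monotoneOn_of_hasDerivWithinAt_nonneg (f' := f') (convex_Icc _ _)
    · exact fun x hx => (h x hx).continuousWithinAt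
    · exact fun x hx => (h x (interior_subset hx)).mono interior_subset
    · exact fun x hx => h0 x (interior_subset hx)
  intro x hx
  exact hm (left_mem_Icc.2 (by norm_num)) hx hx.1

/-- Second order necessary condition at a local minimum. -/
lemma aux_second {u u1 : ℝ → ℝ} {c x : ℝ} (h1 : ∀ᶠ y in 𝓝 x, HasDerivAt u (u1 y) y)
    (h2 : HasDerivAt u1 c x) (hmin : IsLocalMin u x) : u1 x = 0 ∧ 0 ≤ c := by
  have hd : deriv u =ᶠ[𝓝 x] u1 := h1.mono fun y hy => hy.deriv
  have hx : deriv u x = 0 := hmin.deriv_eq_zero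
  have hdd : deriv (deriv u) x = c := by rw [hd.deriv_eq]; exact h2.deriv
  refine ⟨by rw [← hd.eq_of_nhds]; exact hx, ?_⟩
  by_contra hc
  push Not at hc
  have hmax : IsLocalMax u x :=
    isLocalMax_of_deriv_deriv_neg (by rw [hdd]; exact hc) hx h1.self_of_nhds.continuousAt
  have he : u =ᶠ[𝓝 x] fun _ => u x := by
    filter_upwards [hmin, hmax] with y a b using le_antisymm b a
  have h3 : deriv u =ᶠ[𝓝 x] fun _ => 0 := by
    have := he.deriv
    simpa using this
  rw [h3.deriv_eq] at hdd
  simp at hdd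
  linarith

lemma aux_V1 {y : ℝ} (hy : y < 1/2) :
    HasDerivAt (fun y : ℝ => y * ((1/2 - y) * √(1/2 - y)))
      ((1/2 - y) * √(1/2 - y) - 3/2 * y * √(1/2 - y)) y := by
  have hs : 0 < 1/2 - y := by linarith
  have hq := Real.sqrt_pos.2 hs
  have hsq := Real.sq_sqrt hs.le
  have e1 : HasDerivAt (fun y : ℝ => 1/2 - y) (-1) y := 
    (hasDerivAt_id' y).const_sub (1/2)
  have e2 := e1.sqrt hs.ne'
  refine ((hasDerivAt_id' y).mul (e1.mul e2)).congr_deriv ?_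
  simp only [Pi.mul_apply]
  clear e1 e2
  generalize √(1/2 - y) = q at *
  obtain rfl : y = 1/2 - q^2 := by linarith
  field_simp
  ring

lemma aux_V2 {y : ℝ} (hy : y < 1/2) :
    HasDerivAt (fun y : ℝ => (1/2 - y) * √(1/2 - y) - 3/2 * y * √(1/2 - y))
      (-3 * √(1/2 - y) + 3/4 * y / √(1/2 - y)) y := by
  have hs : 0 < 1/2 - y := by linarith
  have hq := Real.sqrt_pos.2 hs
  have hsq := Real.sq_sqrt hs.le
  have e1 : HasDerivAt (fun y : ℝ => 1/2 - y) (-1) y := 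
    (hasDerivAt_id' y).const_sub (1/2)
  have e2 := e1.sqrt hs.ne'
  refine ((e1.mul e2).sub (((hasDerivAt_id' y).const_mul (3/2)).mul e2)).congr_deriv ?_
  clear e1 e2
  generalize √(1/2 - y) = q at *
  obtain rfl : y = 1/2 - q^2 := by linarith
  field_simp
  ring

/-- The uniform lower bound (1.6): there is `C > 0`, independent of `k`, such that every
solution of the approximating problem (1.4) satisfies `φ(η) ≥ C·η·(1/2 − η)^{3/2}`. -/
theorem approximating_solutions_uniform_lower_bound :
    ∃ C > (0:ℝ), ∀ k : ℕ, 1 ≤ k → ∀ φ : ℝ → ℝ,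
      ContDiffOn ℝ 3 φ (Set.Icc 0 (1/2)) →
      (∀ η ∈ Set.Icc (0:ℝ) (1/2), 0 < φ η) →
      (∀ η ∈ Set.Icc (0:ℝ) (1/2),
        iteratedDerivWithin 3 φ (Set.Icc 0 (1/2)) η = 1 / φ η) →
      φ 0 = 1 / k → φ (1/2) = 1 / k →
      derivWithin φ (Set.Icc 0 (1/2)) 0 = 1 →
      ∀ η ∈ Set.Icc (0:ℝ) (1/2),
        C * η * (1/2 - η) ^ ((3:ℝ)/2) ≤ φ η := by
  refine ⟨1, one_pos, ?_⟩
  intro k hk φ hφ hpos hode h0 hL hd0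
  set I : Set ℝ := Icc (0:ℝ) (1/2) with hI
  have hu : UniqueDiffOn ℝ I := uniqueDiffOn_Icc (by norm_num)
  have m0 : (0:ℝ) ∈ I := left_mem_Icc.2 (by norm_num)
  have mL : (1/2:ℝ) ∈ I := right_mem_Icc.2 (by norm_num)
  obtain ⟨D1, hD1⟩ : ∃ D, D = iteratedDerivWithin 1 φ I := ⟨_, rfl⟩
  obtain ⟨D2, hD2⟩ : ∃ D, D = iteratedDerivWithin 2 φ I := ⟨_, rfl⟩
  have key : ∀ m : ℕ, m < 3 → ∀ x ∈ I, HasDerivWithinAt (iteratedDerivWithin m φ I)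
      (iteratedDerivWithin (m+1) φ I x) I x := by
    intro m hm x hx
    rw [iteratedDerivWithin_succ]
    exact (hφ.differentiableOn_iteratedDerivWithin (by exact_mod_cast hm) hu x hx).hasDerivWithinAt
  have H1 : ∀ x ∈ I, HasDerivWithinAt φ (D1 x) I x := by
    intro x hx
    have := key 0 (by norm_num) x hx
    rw [iteratedDerivWithin_zero] at this
    rw [hD1]; exact this
  have H2 : ∀ x ∈ I, HasDerivWithinAt D1 (D2 x) I x := by
    intro x hx
    rw [hD1, hD2]; exact key 1 (by norm_num) x hx
  have H3 : ∀ x ∈ I, HasDerivWithinAt D2 (1 / φ x) I x := by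
    intro x hx
    rw [hD2, ← hode x hx]; exact key 2 (by norm_num) x hx
  have hD10 : D1 0 = 1 := by
    rw [← hd0]; exact ((H1 0 m0).derivWithin (hu 0 m0)).symm
  clear hD1 hD2 key
  -- sign of the initial second derivative
  have hneg : D2 0 ≤ 0 := by
    by_contra hc
    push Not at hc
    have a2 : ∀ x ∈ I, D2 0 ≤ D2 x :=
      aux_mono H3 fun x hx => (one_div_pos.2 (hpos x hx)).le
    have a1 : ∀ x ∈ I, D1 0 ≤ D1 x := aux_mono H2 fun x hx => hc.le.trans (a2 x hx)
    have a0 := aux_mono (f := fun x => φ x - x) (f' := fun x => D1 x - 1)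
      (fun x hx => (H1 x hx).sub (hasDerivWithinAt_id x I))
      (fun x hx => by have := a1 x hx; linarith) (1/2) mL
    simp only [h0, hL] at a0
    linarith
  -- first integral
  have hE : ∀ x ∈ I, φ x * D2 x - D1 x ^ 2 / 2 ≤ -(1/2 - x) := by
    intro x hx
    have hp0 := hpos 0 m0
    have := aux_mono (f := fun x => x - (φ x * D2 x - D1 x ^ 2 / 2)) (f' := fun _ => 0)
      (fun x hx => by
        have hp := hpos x hx
        refine ((hasDerivWithinAt_id x I).sub
          (((H1 x hx).mul (H3 x hx)).sub (((H2 x hx).pow 2).div_const 2))).congr_deriv ?_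
        field_simp
        ring)
      (fun x hx => le_rfl) x hx
    simp only [hD10] at this
    nlinarith
  -- comparison
  obtain ⟨V, hV⟩ : ∃ V : ℝ → ℝ, V = fun y : ℝ => y * ((1/2 - y) * √(1/2 - y)) := ⟨_, rfl⟩
  have hVc : Continuous V := by rw [hV]; fun_prop
  have main : ∀ x ∈ I, V x ≤ φ x := by
    by_contra hcon
    push Not at hcon
    obtain ⟨z, hz, hzlt⟩ := hcon
    have hφc : ContinuousOn φ I := hφ.continuousOn
    obtain ⟨x, hx, hmax⟩ := (isCompact_Icc : IsCompact I).exists_isMaxOn ⟨0, m0⟩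
      (hVc.continuousOn.div hφc fun y hy => (hpos y hy).ne')
    obtain ⟨M, hM⟩ : ∃ M, M = V x / φ x := ⟨_, rfl⟩
    have hmax' : ∀ y ∈ I, V y ≤ M * φ y := by
      intro y hy
      have : V y / φ y ≤ V x / φ x := hmax hy
      rw [← hM, div_le_iff₀ (hpos y hy)] at this
      exact this
    have hpx := hpos x hx
    have hM1 : 1 < M := by
      have := hmax' z hz
      have := hpos z hz
      by_contra hc
      push Not at hc
      nlinarith
    have hMx : V x = M * φ x := by rw [hM]; field_simp
    have hVpos : 0 < V x := by rw [hMx]; positivity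
    have hx0 : 0 < x := by
      rcases hx.1.lt_or_eq with h | h
      · exact h
      · rw [← h, hV] at hVpos; norm_num at hVpos
    have hxL : x < 1/2 := by
      rcases hx.2.lt_or_eq with h | h
      · exact h
      · rw [h, hV] at hVpos; norm_num at hVpos
    have hnear : ∀ᶠ y in 𝓝 x, y ∈ Ioo (0:ℝ) (1/2) := Ioo_mem_nhds hx0 hxL
    have hIn : ∀ y ∈ Ioo (0:ℝ) (1/2), I ∈ 𝓝 y := fun y hy => Icc_mem_nhds hy.1 hy.2
    obtain ⟨c1, c2⟩ := aux_second (x := x) (u := fun y => M * φ y - V y)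
      (u1 := fun y => M * D1 y - ((1/2 - y) * √(1/2 - y) - 3/2 * y * √(1/2 - y)))
      (c := M * D2 x - (-3 * √(1/2 - x) + 3/4 * x / √(1/2 - x)))
      (hnear.mono fun y hy => by
        rw [hV]
        exact (((H1 y (Ioo_subset_Icc_self hy)).hasDerivAt (hIn y hy)).const_mul M).sub
          (aux_V1 hy.2))
      ((((H2 x hx).hasDerivAt (hIn x ⟨hx0, hxL⟩)).const_mul M).sub (aux_V2 hxL))
      (hnear.mono fun y hy => by
        have := hmax' y (Ioo_subset_Icc_self hy)
        show M * φ x - V x ≤ M * φ y - V y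
        linarith)
    have hEx := hE x hx
    have hs : 0 < 1/2 - x := by linarith
    have hsq := Real.sq_sqrt hs.le
    have hq := Real.sqrt_pos.2 hs
    rw [hV] at hMx hVpos
    simp only at c1 hMx hVpos
    generalize hqq : √(1/2 - x) = q at *
    generalize hss : 1/2 - x = s at *
    have hxs : x = 1/2 - s := by linarith
    -- multiply the first integral by M^2
    have b1 : (M * φ x) * (M * D2 x) - (M * D1 x)^2 / 2 ≤ -(M^2 * s) := by
      nlinarith [mul_le_mul_of_nonneg_left hEx (sq_nonneg M)]
    have b2 : M * D1 x = s * q - 3/2 * x * q := by linarith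
    have b3 : (x * (s * q)) * (-3 * q + 3/4 * x / q) ≤ (x * (s * q)) * (M * D2 x) :=
      mul_le_mul_of_nonneg_left (by linarith) hVpos.le
    have b4 : (x * (s * q)) * (-3 * q + 3/4 * x / q) = -3 * x * s * q^2 + 3/4 * x^2 * s := by
      field_simp
    rw [← hMx, b2] at b1
    have b5 : (s * q - 3/2 * x * q)^2 = (s - 3/2 * x)^2 * q^2 := by ring
    rw [b5, hsq] at b1
    rw [b4, hsq] at b3
    have b6 : s < M^2 * s := lt_mul_of_one_lt_left hs (by nlinarith only [hM1])
    have b7 : s^2/2 + 3/2 * x * s + 3/8 * x^2 ≤ 1 := by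
      have hs2 : s < 1/2 := by linarith only [hx0, hxs]
      nlinarith only [hs2, hx0, hs, hxL, mul_pos hs hx0]
    have b8 := mul_le_mul_of_nonneg_left b7 hs.le
    nlinarith only [b8, b1, b3, b6]
  intro η hη
  have hs : 0 ≤ 1/2 - η := by have := hη.2; linarith
  have e : (1/2 - η) ^ ((3:ℝ)/2) = (1/2 - η) * √(1/2 - η) := by
    rcases hs.lt_or_eq with h | h
    · rw [Real.sqrt_eq_rpow, show (3:ℝ)/2 = 1 + 1/2 by norm_num, Real.rpow_add h, Real.rpow_one]
    · rw [← h]; norm_num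
  have := main η hη
  rw [hV] at this
  rw [e, one_mul]
  exact this
end
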